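/- arXiv:1212.2126 — 7 statements merged into one kernel-verified Lean document; each statement's English description precedes it below -/
import Mathlib

section
/- Fix integers N ≥ 1, K ≥ 1, D ≥ 1, data points x_1, …, x_N ∈ ℝ^D, a clustering matrix z ∈ {0,1}^{N×K} (each row has exactly one entry equal to 1 and every column is nonzero) with cluster sizes S_k = Σ_{n=1}^N z_{nk}, cluster means μ_1, …, μ_K ∈ ℝ^D, and constants ρ² > 0 and λ² > 0. For σ² > 0 set θ(σ²) = exp(−λ²/(2σ²)) and define P(σ²) = [Π_{k=1}^K Π_{n: z_{nk}=1} (2πσ²)^{−D/2} exp(−‖x_n − μ_k‖²/(2σ²))] · θ(σ²)^{K−1} · (Γ(θ(σ²)+1)/Γ(θ(σ²)+N)) · Π_{k=1}^K (S_k − 1)! · Π_{k=1}^K (2πρ²)^{−D/2} exp(−‖μ_k‖²/(2ρ²)). Then −2σ² log P(σ²) converges to Σ_{k=1}^K Σ_{n: z_{nk}=1} ‖x_n − μ_k‖² + (K − 1)λ² as σ² → 0⁺. -/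
open Matrix Filter Finset Real

/-- The contribution of one Gaussian factor with variance `s` to `-2 s log P`. -/
theorem neg_two_mul_log_gaussian {s : ℝ} (hs : 0 < s) (d a : ℝ) :
    -2 * s * Real.log ((2 * Real.pi * s) ^ (-d / 2) * Real.exp (-a / (2 * s))) =
      d * (s * Real.log (2 * Real.pi * s)) + a := by
  have hpos : 0 < 2 * Real.pi * s := by positivity
  rw [Real.log_mul (Real.rpow_pos_of_pos hpos _).ne' (Real.exp_pos _).ne',
    Real.log_rpow hpos, Real.log_exp]
  field_simp
  ring

theorem tendsto_mul_log_const_mul_zero {c : ℝ} (hc : 0 < c) :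
    Tendsto (fun s => s * Real.log (c * s)) (nhdsWithin 0 (Set.Ioi 0)) (nhds 0) := by
  have h : Continuous fun s : ℝ => c⁻¹ * (c * s * Real.log (c * s)) :=
    continuous_const.mul (Real.continuous_mul_log.comp (continuous_const.mul continuous_id))
  have h0 := h.tendsto 0
  simp only [mul_zero, zero_mul] at h0
  refine (h0.mono_left nhdsWithin_le_nhds).congr fun s => ?_
  field_simp

theorem tendsto_neg_two_mul_mul_zero {f : ℝ → ℝ} {b : ℝ}
    (hf : Tendsto f (nhdsWithin 0 (Set.Ioi 0)) (nhds b)) :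
    Tendsto (fun s => -2 * s * f s) (nhdsWithin 0 (Set.Ioi 0)) (nhds 0) := by
  have hs : Tendsto (fun s : ℝ => -2 * s) (nhdsWithin 0 (Set.Ioi 0)) (nhds (-2 * 0)) :=
    (tendsto_id.mono_left nhdsWithin_le_nhds).const_mul (-2)
  simpa using hs.mul hf

theorem tendsto_exp_neg_div_two_mul_zero {l : ℝ} (hl : 0 < l) :
    Tendsto (fun s => Real.exp (-l / (2 * s))) (nhdsWithin 0 (Set.Ioi 0)) (nhds 0) := by
  refine Real.tendsto_exp_atBot.comp ?_
  refine (tendsto_inv_nhdsGT_zero.const_mul_atTop_of_neg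
    (show -l / 2 < 0 by linarith)).congr fun s => ?_
  rw [div_mul_eq_div_div, div_eq_mul_inv (-l / 2)]

theorem tendsto_log_Gamma_ratio {α : Type*} {F : Filter α} {θ : α → ℝ}
    (hθ : Tendsto θ F (nhds 0)) {N : ℕ} (hN : 1 ≤ N) :
    Tendsto (fun s => Real.log (Real.Gamma (θ s + 1) / Real.Gamma (θ s + N))) F
      (nhds (Real.log (Real.Gamma 1 / Real.Gamma N))) := by
  have hGamma {b : ℝ} (hb : 0 < b) :
      Tendsto (fun s => Real.Gamma (θ s + b)) F (nhds (Real.Gamma b)) := by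
    refine (Real.differentiableAt_Gamma fun m =>
      ((neg_nonpos.2 m.cast_nonneg).trans_lt hb).ne').continuousAt.tendsto.comp ?_
    simpa using hθ.add_const b
  have hN' : (0 : ℝ) < N := by exact_mod_cast hN
  exact ((hGamma one_pos).div (hGamma hN') (Real.Gamma_pos_of_pos hN').ne').log
    (div_pos (Real.Gamma_pos_of_pos one_pos) (Real.Gamma_pos_of_pos hN')).ne'

/-- Small-variance asymptotics for the CRP Gaussian mixture joint density:
`-2σ² log P(σ²)` converges to the DP-means objective as `σ² → 0⁺`. -/
theorem dp_means_objective_limit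
    (N K D : ℕ) (hN : 1 ≤ N) (hK : 1 ≤ K) (hD : 1 ≤ D)
    (x : Fin N → EuclideanSpace ℝ (Fin D))
    (z : Fin N → Fin K → ℕ)
    (hzbin : ∀ n k, z n k = 0 ∨ z n k = 1)
    (hrow : ∀ n, ∑ k, z n k = 1)
    (hcol : ∀ k, ∃ n, z n k = 1)
    (S : Fin K → ℕ) (hS : ∀ k, S k = ∑ n, z n k)
    (μ : Fin K → EuclideanSpace ℝ (Fin D))
    (ρ2 lam2 : ℝ) (hρ2 : 0 < ρ2) (hlam2 : 0 < lam2)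
    (θ : ℝ → ℝ) (hθ : ∀ s, θ s = Real.exp (-lam2 / (2 * s)))
    (P : ℝ → ℝ)
    (hP : ∀ s, 0 < s → P s =
      (∏ k, ∏ n ∈ univ.filter (fun n => z n k = 1),
          ((2 * Real.pi * s) ^ (-(D : ℝ) / 2) * Real.exp (-‖x n - μ k‖ ^ 2 / (2 * s))))
      * θ s ^ (K - 1)
      * (Real.Gamma (θ s + 1) / Real.Gamma (θ s + N))
      * (∏ k, (Nat.factorial (S k - 1) : ℝ))
      * (∏ k, ((2 * Real.pi * ρ2) ^ (-(D : ℝ) / 2)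
          * Real.exp (-‖μ k‖ ^ 2 / (2 * ρ2))))) :
    Tendsto (fun s => -2 * s * Real.log (P s)) (nhdsWithin 0 (Set.Ioi 0))
      (nhds ((∑ k, ∑ n ∈ univ.filter (fun n => z n k = 1), ‖x n - μ k‖ ^ 2)
        + ((K : ℝ) - 1) * lam2)) := by
  have hGauss {s : ℝ} (hs : 0 < s) (a : ℝ) :
      (2 * Real.pi * s) ^ (-(D : ℝ) / 2) * Real.exp (-a / (2 * s)) ≠ 0 := by positivity
  have hNpos : (0 : ℝ) < N := by exact_mod_cast hN
  set C₁ : ℝ := ∏ k, (Nat.factorial (S k - 1) : ℝ)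
  set C₂ : ℝ := ∏ k, ((2 * Real.pi * ρ2) ^ (-(D : ℝ) / 2)
    * Real.exp (-‖μ k‖ ^ 2 / (2 * ρ2)))
  have hC₁0 : C₁ ≠ 0 := prod_ne_zero_iff.2 fun k _ => by positivity
  have hC₂0 : C₂ ≠ 0 := prod_ne_zero_iff.2 fun k _ => hGauss hρ2 _
  have hexpand : ∀ s, 0 < s →
      (∑ k, ∑ n ∈ univ.filter (fun n => z n k = 1),
          ((D : ℝ) * (s * Real.log (2 * Real.pi * s)) + ‖x n - μ k‖ ^ 2))
        + ((K : ℝ) - 1) * lam2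
        + -2 * s * Real.log (Real.Gamma (θ s + 1) / Real.Gamma (θ s + N))
        + -2 * s * (Real.log C₁ + Real.log C₂) = -2 * s * Real.log (P s) := by
    intro s hs
    have hθpos : 0 < θ s := by rw [hθ]; positivity
    have hθ0 : θ s ^ (K - 1) ≠ 0 := by positivity
    have hG0 : Real.Gamma (θ s + 1) / Real.Gamma (θ s + N) ≠ 0 :=
      (div_pos (Real.Gamma_pos_of_pos (by positivity))
        (Real.Gamma_pos_of_pos (by positivity))).ne'
    have hinner (k : Fin K) : ∏ n ∈ univ.filter (fun n => z n k = 1),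
        ((2 * Real.pi * s) ^ (-(D : ℝ) / 2) * Real.exp (-‖x n - μ k‖ ^ 2 / (2 * s))) ≠ 0 :=
      prod_ne_zero_iff.2 fun n _ => hGauss hs _
    have hL0 := prod_ne_zero_iff.2 fun k (_ : k ∈ univ) => hinner k
    have hweight : -2 * s * Real.log (θ s ^ (K - 1)) = ((K : ℝ) - 1) * lam2 := by
      rw [Real.log_pow, hθ, Real.log_exp, Nat.cast_sub hK, Nat.cast_one]
      field_simp
    rw [hP s hs, Real.log_mul (mul_ne_zero (mul_ne_zero (mul_ne_zero hL0 hθ0) hG0) hC₁0) hC₂0,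
      Real.log_mul (mul_ne_zero (mul_ne_zero hL0 hθ0) hG0) hC₁0,
      Real.log_mul (mul_ne_zero hL0 hθ0) hG0, Real.log_mul hL0 hθ0,
      Real.log_prod fun k _ => hinner k]
    simp_rw [Real.log_prod fun n _ => hGauss hs _, ← neg_two_mul_log_gaussian hs,
      ← mul_sum, ← hweight]
    ring
  refine Tendsto.congr' (eventually_mem_nhdsWithin.mono hexpand) ?_
  have hlog := tendsto_mul_log_const_mul_zero Real.two_pi_pos
  have hθlim : Tendsto θ (nhdsWithin 0 (Set.Ioi 0)) (nhds 0) := by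
    rw [funext hθ]
    exact tendsto_exp_neg_div_two_mul_zero hlam2
  have hsum : Tendsto (fun s => ∑ k, ∑ n ∈ univ.filter (fun n => z n k = 1),
      ((D : ℝ) * (s * Real.log (2 * Real.pi * s)) + ‖x n - μ k‖ ^ 2))
      (nhdsWithin 0 (Set.Ioi 0))
      (nhds (∑ k, ∑ n ∈ univ.filter (fun n => z n k = 1), ‖x n - μ k‖ ^ 2)) :=
    tendsto_finsetSum _ fun k _ => tendsto_finsetSum _ fun n _ => by
      simpa using (hlog.const_mul (D : ℝ)).add_const (‖x n - μ k‖ ^ 2)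
  simpa using ((hsum.add_const (((K : ℝ) - 1) * lam2)).add
    (tendsto_neg_two_mul_mul_zero (tendsto_log_Gamma_ratio hθlim hN))).add
    (tendsto_neg_two_mul_mul_zero tendsto_const_nhds)
end

section
/- Fix integers N ≥ 1, K ≥ 1, D ≥ 1, a data matrix X ∈ ℝ^{N×D}, a binary feature matrix Z ∈ {0,1}^{N×K} in which every column is nonzero, with feature sizes S_k = Σ_{n=1}^N Z_{nk}, a feature-means matrix A ∈ ℝ^{K×D}, and constants ρ² > 0 and λ² > 0. Let H be the number of distinct columns of Z and K̃_1, …, K̃_H the multiplicities of the distinct columns. For σ² > 0 set γ(σ²) = exp(−λ²/(2σ²)) and define P(σ²) = (2πσ²)^{−ND/2} exp(−tr((X − ZA)ᵀ(X − ZA))/(2σ²)) · [γ(σ²)^K exp(−γ(σ²) Σ_{n=1}^N 1/n) / (Π_{h=1}^H K̃_h!)] · Π_{k=1}^K [(S_k − 1)! (N − S_k)! / N!] · (2πρ²)^{−KD/2} exp(−tr(AᵀA)/(2ρ²)). Then −2σ² log P(σ²) converges to tr((X − ZA)ᵀ(X − ZA)) + K λ² as σ² → 0⁺. -/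
open Matrix Filter Finset Real

/-- Multiplying by `-2s` a log-density built from a polynomial factor, two Gibbs factors of
temperature `2s`, a factor `exp (-(g s) * H)` with `g` bounded, and a constant factor leaves only
the two energies as `s → 0⁺`. -/
theorem tendsto_neg_two_mul_log_density
    {a C l : ℝ} (e T H : ℝ) (K : ℕ) (ha : 0 < a) (hC : 0 < C) (hl : 0 ≤ l) :
    Tendsto (fun s => -2 * s * Real.log (((a * s) ^ e * Real.exp (-T / (2 * s)))
        * (Real.exp (-l / (2 * s)) ^ K
          * Real.exp (-(Real.exp (-l / (2 * s))) * H)) * C))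
      (nhdsWithin 0 (Set.Ioi 0)) (nhds (T + K * l)) := by
  have hid : Tendsto (fun s : ℝ => s) (nhdsWithin 0 (Set.Ioi 0)) (nhds 0) :=
    tendsto_id.mono_left nhdsWithin_le_nhds
  have hlog : Tendsto (fun s : ℝ => a * s * Real.log (a * s))
      (nhdsWithin 0 (Set.Ioi 0)) (nhds 0) := by
    have h : Continuous fun s : ℝ => a * s * Real.log (a * s) :=
      Real.continuous_mul_log.comp (continuous_const.mul continuous_id)
    simpa using (h.tendsto 0).mono_left nhdsWithin_le_nhds
  have hexp : Tendsto (fun s : ℝ => s * Real.exp (-l / (2 * s)))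
      (nhdsWithin 0 (Set.Ioi 0)) (nhds 0) := by
    refine tendsto_of_tendsto_of_tendsto_of_le_of_le' tendsto_const_nhds hid ?_ ?_
    · filter_upwards [self_mem_nhdsWithin] with s hs
      have hs : 0 < s := hs
      positivity
    · filter_upwards [self_mem_nhdsWithin] with s hs
      have hs : 0 < s := hs
      refine mul_le_of_le_one_right hs.le (Real.exp_le_one_iff.mpr ?_)
      exact div_nonpos_of_nonpos_of_nonneg (by linarith) (by positivity)
  have hsum := (((hlog.const_mul (-2 * e / a)).add (hexp.const_mul (2 * H))).add
    (hid.const_mul (-2 * Real.log C))).add_const (T + K * l)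
  simp only [mul_zero, zero_add] at hsum
  refine hsum.congr' ?_
  filter_upwards [self_mem_nhdsWithin] with s hs
  have hs : 0 < s := hs
  have has : 0 < a * s := by positivity
  have hpow : 0 < (a * s) ^ e := Real.rpow_pos_of_pos has e
  have hne := fun x : ℝ => Real.exp_ne_zero x
  have hgibbs : (a * s) ^ e * Real.exp (-T / (2 * s)) ≠ 0 := by positivity
  have hmass : Real.exp (-l / (2 * s)) ^ K
      * Real.exp (-(Real.exp (-l / (2 * s))) * H) ≠ 0 := by positivity
  rw [Real.log_mul (mul_ne_zero hgibbs hmass) hC.ne', Real.log_mul hgibbs hmass,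
    Real.log_mul hpow.ne' (hne _), Real.log_mul (pow_ne_zero K (hne _)) (hne _),
    Real.log_pow, Real.log_exp, Real.log_exp, Real.log_exp, Real.log_rpow has]
  field_simp
  ring

/-- Small-variance asymptotics for the IBP linear-Gaussian joint density:
`-2σ² log P(σ²)` converges to the BP-means objective as `σ² → 0⁺`. -/
theorem bp_means_objective_limit
    (N K D : ℕ) (hN : 1 ≤ N) (hK : 1 ≤ K) (hD : 1 ≤ D)
    [DecidableEq (Fin N → ℝ)]
    (X : Matrix (Fin N) (Fin D) ℝ)
    (Z : Matrix (Fin N) (Fin K) ℝ)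
    (hZbin : ∀ n k, Z n k = 0 ∨ Z n k = 1)
    (hcol : ∀ k, ∃ n, Z n k = 1)
    (S : Fin K → ℕ) (hS : ∀ k, (S k : ℝ) = ∑ n, Z n k)
    (A : Matrix (Fin K) (Fin D) ℝ)
    (ρ2 lam2 : ℝ) (hρ2 : 0 < ρ2) (hlam2 : 0 < lam2)
    (γ : ℝ → ℝ) (hγ : ∀ s, γ s = Real.exp (-lam2 / (2 * s)))
    (P : ℝ → ℝ)
    (hP : ∀ s, 0 < s → P s =
      ((2 * Real.pi * s) ^ (-((N : ℝ) * D) / 2)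
        * Real.exp (- Matrix.trace ((X - Z * A)ᵀ * (X - Z * A)) / (2 * s)))
      * (γ s ^ K * Real.exp (-(γ s) * ∑ n ∈ Finset.range N, (1 : ℝ) / (n + 1))
          / ∏ c ∈ univ.image (fun k => fun n => Z n k),
              (Nat.factorial ((univ.filter (fun k => (fun n => Z n k) = c)).card) : ℝ))
      * (∏ k, ((Nat.factorial (S k - 1) : ℝ) * (Nat.factorial (N - S k) : ℝ)
          / (Nat.factorial N : ℝ)))
      * ((2 * Real.pi * ρ2) ^ (-((K : ℝ) * D) / 2)
          * Real.exp (- Matrix.trace (Aᵀ * A) / (2 * ρ2)))) :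
    Tendsto (fun s => -2 * s * Real.log (P s)) (nhdsWithin 0 (Set.Ioi 0))
      (nhds (Matrix.trace ((X - Z * A)ᵀ * (X - Z * A)) + (K : ℝ) * lam2)) := by
  set M : ℝ := ∏ c ∈ univ.image (fun k => fun n => Z n k),
    (Nat.factorial ((univ.filter (fun k => (fun n => Z n k) = c)).card) : ℝ)
  set Q : ℝ := ∏ k, ((Nat.factorial (S k - 1) : ℝ) * (Nat.factorial (N - S k) : ℝ)
    / (Nat.factorial N : ℝ))
  set R : ℝ := (2 * Real.pi * ρ2) ^ (-((K : ℝ) * D) / 2)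
    * Real.exp (- Matrix.trace (Aᵀ * A) / (2 * ρ2))
  have hM : 0 < M := Finset.prod_pos fun c _ => by positivity
  have hQ : 0 < Q := Finset.prod_pos fun k _ => by positivity
  have hR : 0 < R := by positivity
  have ha : 0 < 2 * Real.pi := by positivity
  have hC : 0 < Q * R / M := by positivity
  refine (tendsto_neg_two_mul_log_density (-((N : ℝ) * D) / 2) _
    (∑ n ∈ Finset.range N, (1 : ℝ) / (n + 1)) K ha hC hlam2.le).congr' ?_
  filter_upwards [self_mem_nhdsWithin] with s hs
  rw [hP s hs, hγ s]
  congr 2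
  ring
end

section
/- Fix integers N ≥ 1, K ≥ 1, D ≥ 1, a data matrix X ∈ ℝ^{N×D}, a clustering matrix Z ∈ {0,1}^{N×K} (each row has exactly one entry equal to 1 and every column is nonzero) with cluster sizes S_k = Σ_{n=1}^N Z_{nk}, and constants ρ² > 0 and λ² > 0. For σ² > 0 set θ(σ²) = exp(−λ²/(2σ²)) and define P(σ²) = [(2π)^{ND/2} (σ²)^{(N−K)D/2} (ρ²)^{KD/2} det(ZᵀZ + (σ²/ρ²) I_K)^{D/2}]^{−1} · exp(−tr(Xᵀ(I_N − Z (ZᵀZ + (σ²/ρ²) I_K)^{−1} Zᵀ) X)/(2σ²)) · θ(σ²)^{K−1} · (Γ(θ(σ²)+1)/Γ(θ(σ²)+N)) · Π_{k=1}^K (S_k − 1)!. Then ZᵀZ + (σ²/ρ²) I_K is invertible for every σ² > 0, ZᵀZ is invertible, and −2σ² log P(σ²) converges to tr(Xᵀ(I_N − Z (ZᵀZ)^{−1} Zᵀ) X) + (K − 1)λ² as σ² → 0⁺. -/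
open Matrix Filter Finset Real

/-- The Gram matrix of a one-hot assignment matrix is diagonal, with the column sums as entries. -/
theorem transpose_mul_self_eq_diagonal_of_oneHot {ι κ : Type*} [Fintype ι] [Fintype κ]
    [DecidableEq κ] (Z : Matrix ι κ ℝ) (hbin : ∀ n k, Z n k = 0 ∨ Z n k = 1)
    (hrow : ∀ n, ∑ k, Z n k = 1) :
    Zᵀ * Z = diagonal fun k => ∑ n, Z n k := by
  have hnonneg : ∀ n k, 0 ≤ Z n k := fun n k => by rcases hbin n k with h | h <;> simp [h]
  ext i j
  rw [mul_apply]
  rcases eq_or_ne i j with rfl | hij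
  · rw [diagonal_apply_eq]
    refine sum_congr rfl fun n _ => ?_
    rcases hbin n i with h | h <;> simp [transpose_apply, h]
  · rw [diagonal_apply_ne _ hij]
    refine sum_eq_zero fun n _ => ?_
    have hle : Z n i + Z n j ≤ 1 := by
      rw [← hrow n, ← sum_pair hij]
      exact sum_le_sum_of_subset_of_nonneg (subset_univ _) fun k _ _ => hnonneg n k
    rw [transpose_apply]
    rcases hbin n i with h | h <;> rcases hbin n j with h' | h' <;> simp [h, h']
    linarith

/-- Matrix inversion is continuous at every matrix with nonzero determinant. -/
theorem Filter.Tendsto.matrix_inv_of_det_ne_zero {α κ : Type*} [Fintype κ] [DecidableEq κ]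
    {l : Filter α} {A : α → Matrix κ κ ℝ} {B : Matrix κ κ ℝ} (hA : Tendsto A l (nhds B))
    (hB : B.det ≠ 0) : Tendsto (fun a => (A a)⁻¹) l (nhds B⁻¹) := by
  simp only [Matrix.inv_def, Ring.inverse_eq_inv']
  have hdet : Tendsto (fun a => (A a).det) l (nhds B.det) :=
    (continuous_id.matrix_det.tendsto B).comp hA
  exact (hdet.inv₀ hB).smul ((continuous_id.matrix_adjugate.tendsto B).comp hA)

theorem tendsto_exp_neg_div_nhdsGT_zero {c : ℝ} (hc : 0 < c) :
    Tendsto (fun s : ℝ => Real.exp (-c / (2 * s))) (nhdsWithin 0 (Set.Ioi 0)) (nhds 0) := by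
  refine Real.tendsto_exp_atBot.comp ?_
  have h : Tendsto (fun s : ℝ => -c / 2 * s⁻¹) (nhdsWithin 0 (Set.Ioi 0)) atBot :=
    tendsto_inv_nhdsGT_zero.const_mul_atTop_of_neg (by linarith)
  refine h.congr fun s => ?_
  rw [← div_eq_mul_inv, div_div]

theorem tendsto_log_Gamma_add {α : Type*} {l : Filter α} {θ : α → ℝ} (hθ : Tendsto θ l (nhds 0))
    {a : ℝ} (ha : 0 < a) :
    Tendsto (fun s => Real.log (Real.Gamma (θ s + a))) l (nhds (Real.log (Real.Gamma a))) := by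
  have hadd : Tendsto (fun s => θ s + a) l (nhds a) := by simpa using hθ.add_const a
  have hcont : ContinuousAt Real.Gamma a :=
    (Real.differentiableAt_Gamma fun m => ((neg_nonpos.2 m.cast_nonneg).trans_lt ha).ne').continuousAt
  exact (hcont.tendsto.comp hadd).log (Real.Gamma_pos_of_pos ha).ne'

/-- Small-variance asymptotics for the collapsed CRP Gaussian mixture marginal density:
the regularized Gram matrices are invertible, `ZᵀZ` is invertible, and
`-2σ² log P(σ²)` converges to the collapsed DP-means objective as `σ² → 0⁺`. -/
theorem collapsed_dp_means_objective_limit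
    (N K D : ℕ) (hN : 1 ≤ N) (hK : 1 ≤ K) (hD : 1 ≤ D)
    (X : Matrix (Fin N) (Fin D) ℝ)
    (Z : Matrix (Fin N) (Fin K) ℝ)
    (hZbin : ∀ n k, Z n k = 0 ∨ Z n k = 1)
    (hrow : ∀ n, ∑ k, Z n k = 1)
    (hcol : ∀ k, ∃ n, Z n k = 1)
    (S : Fin K → ℕ) (hS : ∀ k, (S k : ℝ) = ∑ n, Z n k)
    (ρ2 lam2 : ℝ) (hρ2 : 0 < ρ2) (hlam2 : 0 < lam2)
    (θ : ℝ → ℝ) (hθ : ∀ s, θ s = Real.exp (-lam2 / (2 * s)))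
    (P : ℝ → ℝ)
    (hP : ∀ s, 0 < s → P s =
      ((2 * Real.pi) ^ (((N : ℝ) * D) / 2) * s ^ ((((N : ℝ) - K) * D) / 2)
        * ρ2 ^ (((K : ℝ) * D) / 2)
        * (Matrix.det (Zᵀ * Z + (s / ρ2) • (1 : Matrix (Fin K) (Fin K) ℝ))) ^ ((D : ℝ) / 2))⁻¹
      * Real.exp (- Matrix.trace (Xᵀ
          * ((1 : Matrix (Fin N) (Fin N) ℝ)
            - Z * (Zᵀ * Z + (s / ρ2) • (1 : Matrix (Fin K) (Fin K) ℝ))⁻¹ * Zᵀ) * X) / (2 * s))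
      * θ s ^ (K - 1)
      * (Real.Gamma (θ s + 1) / Real.Gamma (θ s + N))
      * (∏ k, (Nat.factorial (S k - 1) : ℝ))) :
    (∀ s : ℝ, 0 < s →
        IsUnit (Zᵀ * Z + (s / ρ2) • (1 : Matrix (Fin K) (Fin K) ℝ)))
    ∧ IsUnit (Zᵀ * Z)
    ∧ Tendsto (fun s => -2 * s * Real.log (P s)) (nhdsWithin 0 (Set.Ioi 0))
        (nhds (Matrix.trace (Xᵀ
            * ((1 : Matrix (Fin N) (Fin N) ℝ) - Z * (Zᵀ * Z)⁻¹ * Zᵀ) * X)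
          + ((K : ℝ) - 1) * lam2)) := by
  have hSpos : ∀ k, 0 < ∑ n, Z n k := fun k => by
    obtain ⟨n, hn⟩ := hcol k
    refine sum_pos' (fun m _ => ?_) ⟨n, mem_univ n, by simp [hn]⟩
    rcases hZbin m k with h | h <;> simp [h]
  have hgram := transpose_mul_self_eq_diagonal_of_oneHot Z hZbin hrow
  have hdet : ∀ s, 0 ≤ s →
      0 < (Zᵀ * Z + (s / ρ2) • (1 : Matrix (Fin K) (Fin K) ℝ)).det := fun s hs => by
    rw [hgram, smul_one_eq_diagonal, diagonal_add, det_diagonal]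
    exact prod_pos fun k _ => add_pos_of_pos_of_nonneg (hSpos k) (by positivity)
  have hdet0 : 0 < (Zᵀ * Z).det := by simpa using hdet 0 le_rfl
  refine ⟨fun s hs => (isUnit_iff_isUnit_det _).2 (hdet s hs.le).ne'.isUnit,
    (isUnit_iff_isUnit_det _).2 hdet0.ne'.isUnit, ?_⟩
  set l : Filter ℝ := nhdsWithin 0 (Set.Ioi 0)
  have hs : Tendsto (fun s : ℝ => s) l (nhds 0) := nhdsWithin_le_nhds
  have hM : Tendsto (fun s : ℝ => Zᵀ * Z + (s / ρ2) • (1 : Matrix (Fin K) (Fin K) ℝ)) l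
      (nhds (Zᵀ * Z)) := by
    have h := ((hs.div_const ρ2).smul_const (1 : Matrix (Fin K) (Fin K) ℝ)).const_add (Zᵀ * Z)
    simpa using h
  have hlogdet := ((continuous_id.matrix_det.tendsto (Zᵀ * Z)).comp hM).log hdet0.ne'
  have hinv := hM.matrix_inv_of_det_ne_zero hdet0.ne'
  have htrace : Tendsto (fun s : ℝ => trace (Xᵀ * ((1 : Matrix (Fin N) (Fin N) ℝ)
      - Z * (Zᵀ * Z + (s / ρ2) • (1 : Matrix (Fin K) (Fin K) ℝ))⁻¹ * Zᵀ) * X)) l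
      (nhds (trace (Xᵀ * ((1 : Matrix (Fin N) (Fin N) ℝ) - Z * (Zᵀ * Z)⁻¹ * Zᵀ) * X))) := by
    have hcont : Continuous fun B : Matrix (Fin K) (Fin K) ℝ =>
        trace (Xᵀ * ((1 : Matrix (Fin N) (Fin N) ℝ) - Z * B * Zᵀ) * X) := by fun_prop
    exact (hcont.tendsto _).comp hinv
  have hθ0 : Tendsto θ l (nhds 0) := by
    rw [funext hθ]
    exact tendsto_exp_neg_div_nhdsGT_zero hlam2
  have hΓ1 := tendsto_log_Gamma_add hθ0 one_pos
  have hΓN := tendsto_log_Gamma_add hθ0 (Nat.cast_pos.2 hN : (0 : ℝ) < N)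
  have hslog : Tendsto (fun s : ℝ => Real.log s * s) l (nhds 0) := by
    simpa using tendsto_log_mul_rpow_nhdsGT_zero one_pos
  set c : ℝ := Real.log ((2 * Real.pi) ^ (((N : ℝ) * D) / 2))
    + Real.log (ρ2 ^ (((K : ℝ) * D) / 2)) - Real.log (∏ k, (Nat.factorial (S k - 1) : ℝ)) with hc
  have hbounded := ((hlogdet.const_mul ((D : ℝ) / 2)).const_add c).sub (hΓ1.sub hΓN)
  have hlim := (((hs.const_mul 2).mul hbounded).add
    (hslog.const_mul (((N : ℝ) - K) * D))).add (htrace.add_const (((K : ℝ) - 1) * lam2))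
  rw [mul_zero, zero_mul, mul_zero, add_zero, zero_add] at hlim
  refine hlim.congr' ?_
  filter_upwards [self_mem_nhdsWithin] with s hs0
  replace hs0 : 0 < s := hs0
  have hθs : 0 < θ s := by rw [hθ]; exact Real.exp_pos _
  have hfac : (∏ k, (Nat.factorial (S k - 1) : ℝ)) ≠ 0 :=
    prod_ne_zero_iff.2 fun k _ => by positivity
  have hG1 : 0 < Real.Gamma (θ s + 1) := Real.Gamma_pos_of_pos (by positivity)
  have hGN : 0 < Real.Gamma (θ s + N) := Real.Gamma_pos_of_pos (by positivity)
  have hds := hdet s hs0.le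
  have hπ : 0 < (2 * Real.pi) ^ (((N : ℝ) * D) / 2) := by positivity
  have hρ : 0 < ρ2 ^ (((K : ℝ) * D) / 2) := by positivity
  have hsp : 0 < s ^ ((((N : ℝ) - K) * D) / 2) := by positivity
  have hdp := Real.rpow_pos_of_pos hds ((D : ℝ) / 2)
  have hlogθ : Real.log (θ s) = -lam2 / (2 * s) := by rw [hθ, Real.log_exp]
  rw [hP s hs0, Real.log_mul (by positivity) hfac, Real.log_mul (by positivity) (by positivity),
    Real.log_mul (by positivity) (by positivity), Real.log_mul (by positivity) (by positivity),
    Real.log_inv, Real.log_mul (by positivity) hdp.ne', Real.log_mul (by positivity) hρ.ne',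
    Real.log_mul hπ.ne' hsp.ne', Real.log_exp, Real.log_pow, Real.log_div hG1.ne' hGN.ne',
    Real.log_rpow hs0, Real.log_rpow hds, hlogθ, Nat.cast_sub hK, hc]
  simp only [Function.comp_apply, id_eq, Nat.cast_one]
  field_simp
  ring
end

section
/- Fix integers N ≥ 1, K ≥ 1, D ≥ 1, a data matrix X ∈ ℝ^{N×D}, a binary feature matrix Z ∈ {0,1}^{N×K} whose columns are linearly independent over ℝ (hence nonzero, so S_k = Σ_{n=1}^N Z_{nk} ≥ 1), and constants ρ² > 0 and λ² > 0. Let H be the number of distinct columns of Z and K̃_1, …, K̃_H their multiplicities. For σ² > 0 set γ(σ²) = exp(−λ²/(2σ²)) and define P(σ²) = [(2π)^{ND/2} (σ²)^{(N−K)D/2} (ρ²)^{KD/2} det(ZᵀZ + (σ²/ρ²) I_K)^{D/2}]^{−1} · exp(−tr(Xᵀ(I_N − Z (ZᵀZ + (σ²/ρ²) I_K)^{−1} Zᵀ) X)/(2σ²)) · [γ(σ²)^K exp(−γ(σ²) Σ_{n=1}^N 1/n) / (Π_{h=1}^H K̃_h!)] · Π_{k=1}^K [(S_k − 1)! (N −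 S_k)! / N!]. Then −2σ² log P(σ²) converges to tr(Xᵀ(I_N − Z (ZᵀZ)^{−1} Zᵀ) X) + K λ² as σ² → 0⁺. -/
open Matrix Filter Finset Real

open Topology in
/-- Small-variance limit of `-2 s log P(s)` for a density of collapsed linear-Gaussian shape with
Gaussian normaliser `A s ^ a B d(s) ^ b`, residual `t(s)` and feature penalty `l`. -/
theorem tendsto_neg_two_mul_log_density_s3
    {A B F C H a b l d₀ t₀ : ℝ} (K : ℕ) (hA : 0 < A) (hB : 0 < B) (hF : 0 < F) (hC : 0 < C)
    (hl : 0 ≤ l) (hd₀ : 0 < d₀) {d t : ℝ → ℝ}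
    (hd : Tendsto d (𝓝[>] 0) (𝓝 d₀)) (ht : Tendsto t (𝓝[>] 0) (𝓝 t₀)) :
    Tendsto (fun s => -2 * s * Real.log ((A * s ^ a * B * d s ^ b)⁻¹
      * Real.exp (-t s / (2 * s))
      * (Real.exp (-l / (2 * s)) ^ K * Real.exp (-Real.exp (-l / (2 * s)) * H) / F) * C))
      (𝓝[>] 0) (𝓝 (t₀ + K * l)) := by
  have hs : Tendsto (fun s : ℝ => s) (𝓝[>] 0) (𝓝 0) :=
    tendsto_nhdsWithin_of_tendsto_nhds tendsto_id
  have hlogs : Tendsto (fun s : ℝ => Real.log s * s) (𝓝[>] 0) (𝓝 0) :=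
    by simpa using tendsto_log_mul_rpow_nhdsGT_zero one_pos
  have hlogd : Tendsto (fun s => Real.log (d s)) (𝓝[>] 0) (𝓝 (Real.log d₀)) :=
    hd.log hd₀.ne'
  have hγ : Tendsto (fun s : ℝ => s * Real.exp (-l / (2 * s))) (𝓝[>] 0) (𝓝 0) := by
    refine squeeze_zero' ?_ ?_ hs <;> filter_upwards [self_mem_nhdsWithin] with s hs
    · exact mul_nonneg (le_of_lt hs) (Real.exp_pos _).le
    · refine mul_le_of_le_one_right (le_of_lt hs) (Real.exp_le_one_iff.2 ?_)
      exact div_nonpos_of_nonpos_of_nonneg (neg_nonpos.2 hl) (mul_pos two_pos hs).le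
  have key : Tendsto (fun s => 2 * s * (Real.log A + Real.log B + Real.log F - Real.log C)
      + 2 * a * (Real.log s * s) + 2 * b * (s * Real.log (d s)) + (t s + K * l)
      + 2 * H * (s * Real.exp (-l / (2 * s)))) (𝓝[>] 0) (𝓝 (t₀ + K * l)) := by
    have := (((((hs.const_mul 2).mul_const
      (Real.log A + Real.log B + Real.log F - Real.log C)).add
      (hlogs.const_mul (2 * a))).add ((hs.mul hlogd).const_mul (2 * b))).add
      (ht.add_const (K * l))).add (hγ.const_mul (2 * H))
    simpa using this
  refine key.congr' ?_
  filter_upwards [self_mem_nhdsWithin, hd.eventually_const_lt hd₀] with s hs hds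
  have hs : 0 < s := hs
  have hsa := Real.rpow_pos_of_pos hs a
  have hdb := Real.rpow_pos_of_pos hds b
  rw [Real.log_mul (by positivity) hC.ne', Real.log_mul (by positivity) (by positivity),
    Real.log_mul (by positivity) (by positivity), Real.log_inv,
    Real.log_mul (by positivity) hdb.ne', Real.log_mul (by positivity) hB.ne',
    Real.log_mul hA.ne' hsa.ne', Real.log_rpow hs, Real.log_rpow hds, Real.log_exp,
    Real.log_div (by positivity) hF.ne', Real.log_mul (by positivity) (by positivity),
    Real.log_pow, Real.log_exp, Real.log_exp]
  field_simp
  ring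

/-- The Gram matrix of linearly independent real columns has positive determinant. -/
theorem det_transpose_mul_self_pos {m n : Type*} [Fintype m] [Fintype n] [DecidableEq n]
    {Z : Matrix m n ℝ} (hZ : LinearIndependent ℝ Z.col) : 0 < (Zᵀ * Z).det := by
  have h := Matrix.PosDef.conjTranspose_mul_self Z (Matrix.mulVec_injective_iff.2 hZ)
  rw [Matrix.conjTranspose_eq_transpose_of_trivial] at h
  exact h.det_pos

open Topology in
/-- Matrix inversion is continuous along a limit with nonzero determinant. -/
theorem tendsto_matrix_inv {α n : Type*} [Fintype n] [DecidableEq n] {l : Filter α}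
    {M : α → Matrix n n ℝ} {M₀ : Matrix n n ℝ} (h₀ : M₀.det ≠ 0) (h : Tendsto M l (𝓝 M₀)) :
    Tendsto (fun x => (M x)⁻¹) l (𝓝 M₀⁻¹) := by
  simp only [Matrix.inv_def, Ring.inverse_eq_inv']
  exact (((continuous_id.matrix_det.tendsto M₀).comp h).inv₀ h₀).smul
    ((continuous_id.matrix_adjugate.tendsto M₀).comp h)

/-- Small-variance asymptotics for the collapsed IBP linear-Gaussian marginal density:
each feature is nonempty (`S k ≥ 1`) and `-2σ² log P(σ²)` converges to the collapsed
BP-means objective as `σ² → 0⁺`. -/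
theorem collapsed_bp_means_objective_limit
    (N K D : ℕ) (hN : 1 ≤ N) (hK : 1 ≤ K) (hD : 1 ≤ D)
    [DecidableEq (Fin N → ℝ)]
    (X : Matrix (Fin N) (Fin D) ℝ)
    (Z : Matrix (Fin N) (Fin K) ℝ)
    (hZbin : ∀ n k, Z n k = 0 ∨ Z n k = 1)
    (hZli : LinearIndependent ℝ (fun k : Fin K => fun n : Fin N => Z n k))
    (S : Fin K → ℕ) (hS : ∀ k, (S k : ℝ) = ∑ n, Z n k)
    (ρ2 lam2 : ℝ) (hρ2 : 0 < ρ2) (hlam2 : 0 < lam2)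
    (γ : ℝ → ℝ) (hγ : ∀ s, γ s = Real.exp (-lam2 / (2 * s)))
    (P : ℝ → ℝ)
    (hP : ∀ s, 0 < s → P s =
      ((2 * Real.pi) ^ (((N : ℝ) * D) / 2) * s ^ ((((N : ℝ) - K) * D) / 2)
        * ρ2 ^ (((K : ℝ) * D) / 2)
        * (Matrix.det (Zᵀ * Z + (s / ρ2) • (1 : Matrix (Fin K) (Fin K) ℝ))) ^ ((D : ℝ) / 2))⁻¹
      * Real.exp (- Matrix.trace (Xᵀ
          * ((1 : Matrix (Fin N) (Fin N) ℝ)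
            - Z * (Zᵀ * Z + (s / ρ2) • (1 : Matrix (Fin K) (Fin K) ℝ))⁻¹ * Zᵀ) * X) / (2 * s))
      * (γ s ^ K * Real.exp (-(γ s) * ∑ n ∈ Finset.range N, (1 : ℝ) / (n + 1))
          / ∏ c ∈ univ.image (fun k => fun n => Z n k),
              (Nat.factorial ((univ.filter (fun k => (fun n => Z n k) = c)).card) : ℝ))
      * (∏ k, ((Nat.factorial (S k - 1) : ℝ) * (Nat.factorial (N - S k) : ℝ)
          / (Nat.factorial N : ℝ)))) :
    (∀ k, 1 ≤ S k)
    ∧ Tendsto (fun s => -2 * s * Real.log (P s)) (nhdsWithin 0 (Set.Ioi 0))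
        (nhds (Matrix.trace (Xᵀ
            * ((1 : Matrix (Fin N) (Fin N) ℝ) - Z * (Zᵀ * Z)⁻¹ * Zᵀ) * X)
          + (K : ℝ) * lam2)) := by
  have hM : Tendsto (fun s : ℝ => Zᵀ * Z + (s / ρ2) • (1 : Matrix (Fin K) (Fin K) ℝ))
      (nhdsWithin 0 (Set.Ioi 0)) (nhds (Zᵀ * Z)) := by
    have hc : Continuous fun s : ℝ => Zᵀ * Z + (s / ρ2) • (1 : Matrix (Fin K) (Fin K) ℝ) := by
      fun_prop
    simpa using (hc.tendsto 0).mono_left nhdsWithin_le_nhds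
  have hdet : 0 < (Zᵀ * Z).det := det_transpose_mul_self_pos hZli
  have hd := (continuous_id.matrix_det.tendsto (Zᵀ * Z)).comp hM
  have htr : Continuous fun W : Matrix (Fin K) (Fin K) ℝ =>
      Matrix.trace (Xᵀ * ((1 : Matrix (Fin N) (Fin N) ℝ) - Z * W * Zᵀ) * X) := by
    fun_prop
  have ht := (htr.tendsto (Zᵀ * Z)⁻¹).comp (tendsto_matrix_inv hdet.ne' hM)
  refine ⟨fun k => ?_, ?_⟩
  · rw [Nat.one_le_iff_ne_zero]
    intro h0
    have hsum := hS k
    rw [h0, Nat.cast_zero, eq_comm, Finset.sum_eq_zero_iff_of_nonneg fun n _ => by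
      rcases hZbin n k with h | h <;> simp [h]] at hsum
    exact hZli.ne_zero k (funext fun n => hsum n (Finset.mem_univ n))
  · have hA : 0 < (2 * Real.pi) ^ (((N : ℝ) * D) / 2) := by positivity
    have hB : 0 < ρ2 ^ (((K : ℝ) * D) / 2) := by positivity
    have hF : 0 < ∏ c ∈ univ.image (fun k => fun n => Z n k),
        (Nat.factorial ((univ.filter (fun k => (fun n => Z n k) = c)).card) : ℝ) :=
      Finset.prod_pos fun c _ => by positivity
    have hC : 0 < ∏ k, ((Nat.factorial (S k - 1) : ℝ) * (Nat.factorial (N - S k) : ℝ)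
        / (Nat.factorial N : ℝ)) := Finset.prod_pos fun k _ => by positivity
    refine (tendsto_neg_two_mul_log_density_s3 (H := ∑ n ∈ Finset.range N, (1 : ℝ) / (n + 1))
      (a := (((N : ℝ) - K) * D) / 2) (b := (D : ℝ) / 2) K hA hB hF hC
      hlam2.le hdet hd ht).congr' ?_
    filter_upwards [self_mem_nhdsWithin] with s hs
    rw [hP s hs, hγ s]
    rfl
end

section
/- Let N ≥ 1, K ≥ 1, D ≥ 1 be integers, X ∈ ℝ^{N×D} a data matrix with rows x_1, …, x_N, and Z ∈ {0,1}^{N×K} a clustering matrix (each row has exactly one entry equal to 1 and every column is nonzero) with cluster sizes S_k = Σ_{n=1}^N Z_{nk}. For each k let x̄^{(k)} = S_k^{−1} Σ_{m: Z_{mk}=1} x_m be the empirical mean of cluster k. Then ZᵀZ is invertible and tr(Xᵀ(I_N − Z (ZᵀZ)^{−1} Zᵀ) X) = Σ_{k=1}^K Σ_{n: Z_{nk}=1} ‖x_n − x̄^{(k)}‖². -/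
open Matrix Filter Finset Real

/-- The Gram matrix of a `0`-`1` matrix with unit row sums is the diagonal matrix of its
column sums. -/
theorem transpose_mul_self_eq_diagonal_of_binary {ι κ : Type*} [Fintype ι] [Fintype κ]
    [DecidableEq κ] (Z : Matrix ι κ ℝ) (hZbin : ∀ n k, Z n k = 0 ∨ Z n k = 1)
    (hrow : ∀ n, ∑ k, Z n k = 1) :
    Zᵀ * Z = diagonal fun k => ∑ n, Z n k := by
  have hnonneg : ∀ n k, 0 ≤ Z n k := fun n k => by rcases hZbin n k with h | h <;> simp [h]
  ext j k
  simp only [mul_apply, transpose_apply, diagonal_apply]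
  split_ifs with hjk
  · subst hjk
    exact sum_congr rfl fun n _ => by rcases hZbin n j with h | h <;> simp [h]
  · refine sum_eq_zero fun n _ => ?_
    have hpair : Z n j + Z n k ≤ 1 := by
      rw [← hrow n, ← sum_pair hjk]
      exact sum_le_sum_of_subset_of_nonneg (subset_univ _) fun i _ _ => hnonneg n i
    rcases hZbin n j with h | h
    · simp [h]
    · have hzero : Z n k = 0 := le_antisymm (by linarith) (hnonneg n k)
      simp [hzero]

theorem trace_transpose_mul_one_sub_mul_diagonal {ι κ δ : Type*} [Fintype ι] [Fintype κ]
    [Fintype δ] [DecidableEq ι] [DecidableEq κ] (X : Matrix ι δ ℝ) (Z : Matrix ι κ ℝ)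
    (w : κ → ℝ) :
    Matrix.trace (Xᵀ * (1 - Z * diagonal w * Zᵀ) * X)
      = ∑ d, (∑ n, X n d ^ 2 - ∑ k, w k * (∑ n, Z n k * X n d) ^ 2) := by
  have hsplit : Xᵀ * (1 - Z * diagonal w * Zᵀ) * X
      = Xᵀ * X - (Zᵀ * X)ᵀ * (diagonal w * (Zᵀ * X)) := by
    simp only [Matrix.mul_sub, Matrix.sub_mul, Matrix.mul_one, transpose_mul,
      transpose_transpose, Matrix.mul_assoc]
  rw [hsplit, Matrix.trace]
  refine sum_congr rfl fun d _ => ?_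
  rw [diag_apply, Matrix.sub_apply, mul_apply, mul_apply]
  simp only [diagonal_mul, transpose_apply]
  congr 1
  · exact sum_congr rfl fun n _ => by ring
  · refine sum_congr rfl fun k _ => ?_
    simp only [mul_apply, transpose_apply]
    ring

/-- The weighted sum of squared deviations from the weighted mean. -/
theorem sum_mul_sub_weighted_mean_sq {ι : Type*} [Fintype ι] (z y : ι → ℝ)
    (hz : ∑ n, z n ≠ 0) :
    ∑ n, z n * (y n - (∑ m, z m)⁻¹ * ∑ m, z m * y m) ^ 2
      = ∑ n, z n * y n ^ 2 - (∑ n, z n)⁻¹ * (∑ n, z n * y n) ^ 2 := by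
  have hexpand : ∀ a : ℝ, ∑ n, z n * (y n - a) ^ 2
      = ∑ n, z n * y n ^ 2 - 2 * a * ∑ n, z n * y n + a ^ 2 * ∑ n, z n := by
    intro a
    simp only [mul_sum, ← sum_sub_distrib, ← sum_add_distrib]
    exact sum_congr rfl fun n _ => by ring
  rw [hexpand]
  field_simp
  ring

/-- The collapsed DP-means trace term equals the within-cluster sum of squared
Euclidean distances to the empirical cluster means. -/
theorem collapsed_trace_eq_within_cluster_ssq
    (N K D : ℕ) (hN : 1 ≤ N) (hK : 1 ≤ K) (hD : 1 ≤ D)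
    (X : Matrix (Fin N) (Fin D) ℝ)
    (x : Fin N → EuclideanSpace ℝ (Fin D)) (hx : ∀ n d, x n d = X n d)
    (Z : Matrix (Fin N) (Fin K) ℝ)
    (hZbin : ∀ n k, Z n k = 0 ∨ Z n k = 1)
    (hrow : ∀ n, ∑ k, Z n k = 1)
    (hcol : ∀ k, ∃ n, Z n k = 1)
    (S : Fin K → ℕ) (hS : ∀ k, (S k : ℝ) = ∑ n, Z n k)
    (xbar : Fin K → EuclideanSpace ℝ (Fin D))
    (hxbar : ∀ k, xbar k = ((S k : ℝ))⁻¹ • ∑ m ∈ univ.filter (fun m => Z m k = 1), x m) :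
    IsUnit (Zᵀ * Z)
    ∧ Matrix.trace (Xᵀ * ((1 : Matrix (Fin N) (Fin N) ℝ) - Z * (Zᵀ * Z)⁻¹ * Zᵀ) * X)
      = ∑ k, ∑ n ∈ univ.filter (fun n => Z n k = 1), ‖x n - xbar k‖ ^ 2 := by
  have hfilter : ∀ (k : Fin K) (f : Fin N → ℝ),
      ∑ n ∈ univ.filter (fun n => Z n k = 1), f n = ∑ n, Z n k * f n := by
    intro k f
    rw [sum_filter]
    exact sum_congr rfl fun n _ => by rcases hZbin n k with h | h <;> simp [h]
  have hpos : ∀ k, 0 < ∑ n, Z n k := by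
    intro k
    obtain ⟨n, hn⟩ := hcol k
    refine sum_pos' (fun m _ => ?_) ⟨n, mem_univ n, by simp [hn]⟩
    rcases hZbin m k with h | h <;> simp [h]
  have hinv : Zᵀ * Z * diagonal (fun k => (∑ n, Z n k)⁻¹) = 1 := by
    rw [transpose_mul_self_eq_diagonal_of_binary Z hZbin hrow, diagonal_mul_diagonal,
      ← diagonal_one]
    exact congrArg diagonal (funext fun k => mul_inv_cancel₀ (hpos k).ne')
  refine ⟨IsUnit.of_mul_eq_one _ hinv, ?_⟩
  have hmean : ∀ k d, xbar k d = (∑ n, Z n k)⁻¹ * ∑ n, Z n k * X n d := by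
    intro k d
    rw [hxbar, hS, ← hfilter]
    simp [hx]
  have hcluster : ∀ k, ∑ n ∈ univ.filter (fun n => Z n k = 1), ‖x n - xbar k‖ ^ 2
      = ∑ d, (∑ n, Z n k * X n d ^ 2 - (∑ n, Z n k)⁻¹ * (∑ n, Z n k * X n d) ^ 2) := by
    intro k
    rw [hfilter]
    simp only [EuclideanSpace.real_norm_sq_eq, PiLp.sub_apply, hx, hmean, mul_sum (ι := Fin D)]
    rw [sum_comm]
    exact sum_congr rfl fun d _ =>
      sum_mul_sub_weighted_mean_sq (fun n => Z n k) (fun n => X n d) (hpos k).ne'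
  rw [Matrix.inv_eq_right_inv hinv, trace_transpose_mul_one_sub_mul_diagonal,
    sum_congr rfl fun k _ => hcluster k, sum_comm]
  refine sum_congr rfl fun d _ => ?_
  rw [sum_sub_distrib, sum_comm]
  simp only [← sum_mul, hrow, one_mul]
end

section
/- Fix integers N ≥ 1, K ≥ 2, D ≥ 1, data points x_1, …, x_N ∈ ℝ^D, an assignment z ∈ {0,1}^{N×K} with exactly one entry equal to 1 in each row (empty clusters are allowed), cluster sizes S_k = Σ_{n=1}^N z_{nk}, cluster means μ_1, …, μ_K ∈ ℝ^D, and constants θ > 0 and ρ² > 0. For σ² > 0 define P(σ²) = [Π_{k=1}^K Π_{n: z_{nk}=1} (2πσ²)^{−D/2} exp(−‖x_n − μ_k‖²/(2σ²))] · (Γ(Kθ)/Γ(N + Kθ)) · Π_{k=1}^K (Γ(S_k + θ)/Γ(θ)) · Π_{k=1}^K (2πρ²)^{−D/2} exp(−‖μ_k‖²/(2ρ²)). Then −2σ² log P(σ²) converges to Σ_{k=1}^K Σ_{n: z_{nk}=1} ‖x_n − μ_k‖² as σ² → 0⁺. -/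
open Matrix Filter Finset Real

/-- Scaling the log-density of a spherical Gaussian of variance `s` by `-2 * s` recovers the squared
distance `d` to the mean as `s → 0⁺`. -/
lemma tendsto_neg_two_mul_log_gaussian (a d : ℝ) :
    Tendsto (fun s => -2 * s * Real.log ((2 * Real.pi * s) ^ (-a / 2) * Real.exp (-d / (2 * s))))
      (nhdsWithin 0 (Set.Ioi 0)) (nhds d) := by
  have hcont : Continuous fun s : ℝ =>
      a / (2 * Real.pi) * ((2 * Real.pi * s) * Real.log (2 * Real.pi * s)) + d :=
    ((Real.continuous_mul_log.comp (continuous_const.mul continuous_id)).const_mul _).add_const _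
  have hlim := (hcont.tendsto 0).mono_left (nhdsWithin_le_nhds (s := Set.Ioi 0))
  simp only [mul_zero, zero_mul, zero_add] at hlim
  refine hlim.congr' ?_
  filter_upwards [self_mem_nhdsWithin] with s hs
  have hs : 0 < s := hs
  have hpos : 0 < 2 * Real.pi * s := by positivity
  rw [Real.log_mul (Real.rpow_pos_of_pos hpos _).ne' (Real.exp_ne_zero _),
    Real.log_rpow hpos, Real.log_exp]
  field_simp
  ring

/-- A log-density term `c` that does not depend on `s` vanishes after scaling by `-2 * s`. -/
lemma tendsto_neg_two_mul_const (c : ℝ) :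
    Tendsto (fun s : ℝ => -2 * s * c) (nhdsWithin 0 (Set.Ioi 0)) (nhds 0) := by
  have hcont : Continuous fun s : ℝ => -2 * s * c := by fun_prop
  simpa using (hcont.tendsto 0).mono_left (nhdsWithin_le_nhds (s := Set.Ioi 0))

/-- Small-variance asymptotics for the Dirichlet-multinomial Gaussian mixture with fixed
concentration `θ`: `-2σ² log P(σ²)` converges to the K-means objective as `σ² → 0⁺`. -/
theorem k_means_objective_limit
    (N K D : ℕ) (hN : 1 ≤ N) (hK : 2 ≤ K) (hD : 1 ≤ D)
    (x : Fin N → EuclideanSpace ℝ (Fin D))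
    (z : Fin N → Fin K → ℕ)
    (hzbin : ∀ n k, z n k = 0 ∨ z n k = 1)
    (hrow : ∀ n, ∑ k, z n k = 1)
    (S : Fin K → ℕ) (hS : ∀ k, S k = ∑ n, z n k)
    (μ : Fin K → EuclideanSpace ℝ (Fin D))
    (θ ρ2 : ℝ) (hθ : 0 < θ) (hρ2 : 0 < ρ2)
    (P : ℝ → ℝ)
    (hP : ∀ s, 0 < s → P s =
      (∏ k, ∏ n ∈ univ.filter (fun n => z n k = 1),
          ((2 * Real.pi * s) ^ (-(D : ℝ) / 2) * Real.exp (-‖x n - μ k‖ ^ 2 / (2 * s))))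
      * (Real.Gamma (K * θ) / Real.Gamma (N + K * θ))
      * (∏ k, (Real.Gamma (S k + θ) / Real.Gamma θ))
      * (∏ k, ((2 * Real.pi * ρ2) ^ (-(D : ℝ) / 2)
          * Real.exp (-‖μ k‖ ^ 2 / (2 * ρ2))))) :
    Tendsto (fun s => -2 * s * Real.log (P s)) (nhdsWithin 0 (Set.Ioi 0))
      (nhds (∑ k, ∑ n ∈ univ.filter (fun n => z n k = 1), ‖x n - μ k‖ ^ 2)) := by
  have hKpos : (0 : ℝ) < K := by exact_mod_cast (by lia : 0 < K)
  set c : ℝ := (Real.Gamma (K * θ) / Real.Gamma (N + K * θ))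
      * (∏ k, (Real.Gamma (S k + θ) / Real.Gamma θ))
      * (∏ k, ((2 * Real.pi * ρ2) ^ (-(D : ℝ) / 2)
          * Real.exp (-‖μ k‖ ^ 2 / (2 * ρ2)))) with hc
  have hcpos : 0 < c := by
    have h₁ : 0 < Real.Gamma (K * θ) := Real.Gamma_pos_of_pos (by positivity)
    have h₂ : 0 < Real.Gamma (N + K * θ) := Real.Gamma_pos_of_pos (by positivity)
    have h₃ : 0 < ∏ k, (Real.Gamma (S k + θ) / Real.Gamma θ) :=
      prod_pos fun k _ => div_pos (Real.Gamma_pos_of_pos (by positivity))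
        (Real.Gamma_pos_of_pos hθ)
    positivity
  have hlim := (tendsto_finsetSum univ fun k _ =>
    tendsto_finsetSum (univ.filter fun n => z n k = 1) fun n _ =>
      tendsto_neg_two_mul_log_gaussian D (‖x n - μ k‖ ^ 2)).add
    (tendsto_neg_two_mul_const (Real.log c))
  rw [add_zero] at hlim
  refine hlim.congr' ?_
  filter_upwards [self_mem_nhdsWithin] with s hs
  have hs : 0 < s := hs
  have hfactor : ∀ k n, 0 < (2 * Real.pi * s) ^ (-(D : ℝ) / 2)
      * Real.exp (-‖x n - μ k‖ ^ 2 / (2 * s)) := fun k n => by positivity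
  have hsplit : P s = (∏ k, ∏ n ∈ univ.filter (fun n => z n k = 1),
      ((2 * Real.pi * s) ^ (-(D : ℝ) / 2) * Real.exp (-‖x n - μ k‖ ^ 2 / (2 * s)))) * c := by
    rw [hP s hs, hc]
    ring
  rw [hsplit,
    Real.log_mul (prod_pos fun k _ => prod_pos fun n _ => hfactor k n).ne' hcpos.ne',
    Real.log_prod fun k _ => (prod_pos fun n _ => hfactor k n).ne', mul_add, mul_sum]
  congr 1
  refine sum_congr rfl fun k _ => ?_
  rw [Real.log_prod fun n _ => (hfactor k n).ne', mul_sum]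
end

section
/- Fix integers N ≥ 1 and D ≥ 1, a data matrix X ∈ ℝ^{N×D}, and a constant λ² > 0. Let 𝒵 be the set of all binary matrices Z with N rows and some finite number K(Z) ≥ 1 of columns such that the columns of Z are nonzero, pairwise distinct, and linearly independent over ℝ (so ZᵀZ is invertible), and define g(Z) = tr(Xᵀ(I_N − Z(ZᵀZ)^{−1}Zᵀ)X) + K(Z)λ². Then the set of values {g(Z) : Z ∈ 𝒵} is finite, and consequently there exists no sequence (Z_t)_{t ∈ ℕ} in 𝒵 with g(Z_{t+1}) < g(Z_t) for every t ∈ ℕ. -/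
open Matrix Finset Real

/-- There are only finitely many binary matrices of a given finite shape. -/
theorem finite_setOf_binary_matrix (m n : Type*) [Finite m] [Finite n] :
    {Z : Matrix m n ℝ | ∀ i j, Z i j = 0 ∨ Z i j = 1}.Finite := by
  have h : {Z : m → n → ℝ | ∀ i, Z i ∈ {z : n → ℝ | ∀ j, z j ∈ ({0, 1} : Set ℝ)}}.Finite :=
    Set.Finite.pi' fun _ => Set.Finite.pi' fun _ => Set.toFinite _
  exact h.subset fun Z hZ i j => hZ i j

/-- A function on binary matrices with `N` rows takes finitely many values on those with
linearly independent columns, whatever their number of columns. -/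
theorem finite_values_of_binary_linearIndependent {α : Type*} (N : ℕ)
    (g : ∀ K : ℕ, Matrix (Fin N) (Fin K) ℝ → α) :
    {v : α | ∃ (K : ℕ) (Z : Matrix (Fin N) (Fin K) ℝ), (∀ n k, Z n k = 0 ∨ Z n k = 1)
      ∧ LinearIndependent ℝ (fun k : Fin K => fun n : Fin N => Z n k) ∧ v = g K Z}.Finite := by
  have h : (⋃ K ∈ Set.Iic N,
      g K '' {Z | ∀ n k, Z n k = 0 ∨ Z n k = 1}).Finite :=
    (Set.finite_Iic N).biUnion fun K _ => (finite_setOf_binary_matrix _ _).image (g K)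
  refine h.subset ?_
  rintro v ⟨K, Z, hZ, hli, rfl⟩
  have hK : K ≤ N := by simpa using hli.fintype_card_le_finrank
  exact Set.mem_biUnion (Set.mem_Iic.2 hK) (Set.mem_image_of_mem _ hZ)

/-- The collapsed BP-means objective `g(Z) = tr(Xᵀ(I − Z(ZᵀZ)⁻¹Zᵀ)X) + K(Z)λ²` takes
only finitely many values over binary matrices `Z` with nonzero, pairwise distinct,
linearly independent columns; consequently no sequence of such matrices can make the
objective strictly decrease forever. -/
theorem bp_means_no_infinite_descent
    (N D : ℕ) (hN : 1 ≤ N) (hD : 1 ≤ D)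
    (X : Matrix (Fin N) (Fin D) ℝ)
    (lam2 : ℝ) (hlam2 : 0 < lam2) :
    ({v : ℝ | ∃ (K : ℕ) (Z : Matrix (Fin N) (Fin K) ℝ), 1 ≤ K
        ∧ (∀ n k, Z n k = 0 ∨ Z n k = 1)
        ∧ (∀ k, ∃ n, Z n k ≠ 0)
        ∧ (∀ k k' : Fin K, k ≠ k' → (fun n => Z n k) ≠ (fun n => Z n k'))
        ∧ LinearIndependent ℝ (fun k : Fin K => fun n : Fin N => Z n k)
        ∧ v = Matrix.trace (Xᵀ
            * ((1 : Matrix (Fin N) (Fin N) ℝ) - Z * (Zᵀ * Z)⁻¹ * Zᵀ) * X)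
          + (K : ℝ) * lam2}).Finite
    ∧ ¬ ∃ (Kt : ℕ → ℕ) (Zt : ∀ t : ℕ, Matrix (Fin N) (Fin (Kt t)) ℝ),
        (∀ t : ℕ, 1 ≤ Kt t
          ∧ (∀ n k, Zt t n k = 0 ∨ Zt t n k = 1)
          ∧ (∀ k, ∃ n, Zt t n k ≠ 0)
          ∧ (∀ k k' : Fin (Kt t), k ≠ k' → (fun n => Zt t n k) ≠ (fun n => Zt t n k'))
          ∧ LinearIndependent ℝ (fun k : Fin (Kt t) => fun n : Fin N => Zt t n k))
        ∧ (∀ t : ℕ,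
            Matrix.trace (Xᵀ * ((1 : Matrix (Fin N) (Fin N) ℝ)
              - Zt (t + 1) * ((Zt (t + 1))ᵀ * Zt (t + 1))⁻¹ * (Zt (t + 1))ᵀ) * X)
              + (Kt (t + 1) : ℝ) * lam2
            < Matrix.trace (Xᵀ * ((1 : Matrix (Fin N) (Fin N) ℝ)
              - Zt t * ((Zt t)ᵀ * Zt t)⁻¹ * (Zt t)ᵀ) * X)
              + (Kt t : ℝ) * lam2) := by
  let g : ∀ K : ℕ, Matrix (Fin N) (Fin K) ℝ → ℝ := fun K Z =>
    Matrix.trace (Xᵀ * ((1 : Matrix (Fin N) (Fin N) ℝ) - Z * (Zᵀ * Z)⁻¹ * Zᵀ) * X)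
      + (K : ℝ) * lam2
  have hfin := finite_values_of_binary_linearIndependent N g
  refine ⟨hfin.subset ?_, ?_⟩
  · rintro v ⟨K, Z, -, hZ, -, -, hli, hv⟩
    exact ⟨K, Z, hZ, hli, hv⟩
  · rintro ⟨Kt, Zt, hZt, hlt⟩
    have hanti : StrictAnti fun t => g (Kt t) (Zt t) := strictAnti_nat_of_succ_lt hlt
    refine Set.infinite_of_injective_forall_mem hanti.injective (fun t => ?_) hfin
    obtain ⟨-, hZ, -, -, hli⟩ := hZt t
    exact ⟨Kt t, Zt t, hZ, hli, rfl⟩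
end
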